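/- arXiv:1211.7155 — 4 statements merged into one kernel-verified Lean document; each statement's English description precedes it below -/
import Mathlib

section
/- Let H be a complex Hilbert space, let u ∈ H, and let (w_k)_{k≥1} be a sequence of pairwise orthogonal vectors in H with supremum of the norms ‖w_k‖ finite. Set v_k := u + w_k for each k. Then the averages (v_1 + ⋯ + v_n)/n converge in norm to u as n → ∞; in particular, u belongs to the closed linear span of {v_k : k ≥ 1}. (The averaging argument at the core of the theorem that the projections (P_E v_1, …, P_E v_n) form a canonical base, yielding weak elimination of imaginaries.) -/
open scoped ComplexInnerProductSpace

theorem norm_sum_sq_le_aux {H : Type*} [NormedAddCommGroup H] [InnerProductSpace ℂ H]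
    (w : ℕ → H) (horth : ∀ j k : ℕ, j ≠ k → ⟪w j, w k⟫ = 0)
    (C : ℝ) (hC : ∀ k : ℕ, ‖w k‖ ≤ C) (n : ℕ) :
    ‖∑ k ∈ Finset.Icc 1 n, w k‖ ^ 2 ≤ n * C ^ 2 := by
  induction n with
  | zero => simp
  | succ n ih =>
    rw [Finset.sum_Icc_succ_top (by omega)]
    have h0 : ⟪∑ k ∈ Finset.Icc 1 n, w k, w (n + 1)⟫ = 0 := by
      rw [sum_inner]
      refine Finset.sum_eq_zero fun k hk => horth _ _ ?_
      have := (Finset.mem_Icc.mp hk).2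
      omega
    have h1 := norm_add_sq_eq_norm_sq_add_norm_sq_of_inner_eq_zero _ _ h0
    have h2 : ‖w (n + 1)‖ ^ 2 ≤ C ^ 2 := pow_le_pow_left₀ (norm_nonneg _) (hC _) 2
    push_cast
    nlinarith

/-- Averaging argument: if `(w_k)_{k ≥ 1}` are pairwise orthogonal vectors with uniformly
bounded norms and `v_k = u + w_k`, then the averages `(v_1 + ⋯ + v_n)/n` converge in norm
to `u`; in particular `u` lies in the closed linear span of `{v_k : k ≥ 1}`. -/
theorem statement8 {H : Type*} [NormedAddCommGroup H] [InnerProductSpace ℂ H]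
    [CompleteSpace H]
    (u : H) (w : ℕ → H)
    (horth : ∀ j k : ℕ, j ≠ k → ⟪w j, w k⟫ = 0)
    (C : ℝ) (hC : ∀ k : ℕ, ‖w k‖ ≤ C)
    (v : ℕ → H) (hv : ∀ k : ℕ, v k = u + w k) :
    Filter.Tendsto (fun n : ℕ => (n : ℂ)⁻¹ • ∑ k ∈ Finset.Icc 1 n, v k)
      Filter.atTop (nhds u) ∧
    u ∈ (Submodule.span ℂ {x : H | ∃ k : ℕ, 1 ≤ k ∧ x = v k}).topologicalClosure := by
  have key : Filter.Tendsto (fun n : ℕ => (n : ℂ)⁻¹ • ∑ k ∈ Finset.Icc 1 n, v k)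
      Filter.atTop (nhds u) := by
    rw [tendsto_iff_norm_sub_tendsto_zero]
    have hlim : Filter.Tendsto (fun n : ℕ => Real.sqrt (C ^ 2 / (n : ℝ)))
        Filter.atTop (nhds 0) := by
      have := (tendsto_const_div_atTop_nhds_zero_nat (C ^ 2)).sqrt
      simpa using this
    refine squeeze_zero' (Filter.Eventually.of_forall fun n => norm_nonneg _) ?_ hlim
    filter_upwards [Filter.eventually_gt_atTop 0] with n hn
    have hn' : (0 : ℝ) < n := by exact_mod_cast hn
    have hnc : (n : ℂ) ≠ 0 := by exact_mod_cast hn.ne'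
    have e : (n : ℂ)⁻¹ • ∑ k ∈ Finset.Icc 1 n, v k - u
        = (n : ℂ)⁻¹ • ∑ k ∈ Finset.Icc 1 n, w k := by
      simp only [hv, Finset.sum_add_distrib, Finset.sum_const, Nat.card_Icc, smul_add,
        Nat.add_sub_cancel]
      rw [← Nat.cast_smul_eq_nsmul ℂ, smul_smul, inv_mul_cancel₀ hnc, one_smul]
      abel
    rw [e]
    apply Real.le_sqrt_of_sq_le
    rw [norm_smul, mul_pow, norm_inv, Complex.norm_natCast, le_div_iff₀ hn']
    have h := norm_sum_sq_le_aux w horth C hC n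
    calc ((n : ℝ)⁻¹) ^ 2 * ‖∑ k ∈ Finset.Icc 1 n, w k‖ ^ 2 * n
        ≤ ((n : ℝ)⁻¹) ^ 2 * (n * C ^ 2) * n := by gcongr
      _ = C ^ 2 := by field_simp
  refine ⟨key, ?_⟩
  refine mem_closure_of_tendsto key (Filter.Eventually.of_forall fun n => ?_)
  refine Submodule.smul_mem _ _ (Submodule.sum_mem _ fun k hk => Submodule.subset_span ?_)
  exact ⟨k, (Finset.mem_Icc.mp hk).1, rfl⟩
end

section
/- Let φ₁, φ₂, ψ₁ and ψ₂ be positive continuous linear functionals on A such that there exist real numbers γ₁ > 0 and γ₂ > 0 for which γ₁φ₂ − φ₁ and γ₂ψ₂ − ψ₁ are positive (i.e. φ₁ is dominated by φ₂ and ψ₁ is dominated by ψ₂). If φ₂ and ψ₂ are orthogonal, i.e. ‖φ₂ − ψ₂‖ = ‖φ₂‖ + ‖ψ₂‖, then φ₁ and ψ₁ are orthogonal, i.e. ‖φ₁ − ψ₁‖ = ‖φ₁‖ + ‖ψ₁‖. -/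
open scoped ComplexOrder

/-- A continuous linear functional on a C*-algebra is positive if it is nonnegative on
elements of the form `a⋆ a`. -/
def IsPositiveFunctional {A : Type*} [CStarAlgebra A] (φ : A →L[ℂ] ℂ) : Prop :=
  ∀ a : A, 0 ≤ φ (star a * a)

theorem aux_sq {A : Type*} [CStarAlgebra A] (a : A) (ha : IsSelfAdjoint a) (r : ℝ)
    (hn : ‖a‖ ≤ r) : ∃ b : A, star b * b = (r : ℂ) • (1 : A) - a := by
  let := CStarAlgebra.spectralOrder A
  let := CStarAlgebra.spectralOrderedRing A
  have h1 : a ≤ algebraMap ℝ A ‖a‖ := ha.le_algebraMap_norm_self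
  have h2 : algebraMap ℝ A ‖a‖ ≤ algebraMap ℝ A r := algebraMap_mono A hn
  have h3 : 0 ≤ algebraMap ℝ A r - a := sub_nonneg.2 (h1.trans h2)
  obtain ⟨b, hb⟩ := CStarAlgebra.nonneg_iff_eq_star_mul_self.1 h3
  refine ⟨b, hb.symm.trans ?_⟩
  rw [Algebra.algebraMap_eq_smul_one]
  simp

theorem aux_sub {A : Type*} [CStarAlgebra A] {φ : A →L[ℂ] ℂ} (hφ : IsPositiveFunctional φ)
    (a : A) (ha : IsSelfAdjoint a) (r : ℝ)
    (hn : ‖a‖ ≤ r) : 0 ≤ (r : ℂ) * φ 1 - φ a := by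
  obtain ⟨b, hb⟩ := aux_sq a ha r hn
  have := hφ b
  rw [hb] at this
  simpa using this

theorem aux_one {A : Type*} [CStarAlgebra A] {φ : A →L[ℂ] ℂ} (hφ : IsPositiveFunctional φ) :
    0 ≤ φ 1 := by
  simpa using hφ 1

theorem aux_im {A : Type*} [CStarAlgebra A] {φ : A →L[ℂ] ℂ} (hφ : IsPositiveFunctional φ)
    (a : A) (ha : IsSelfAdjoint a) : (φ a).im = 0 := by
  have h1 := (Complex.le_def.1 (aux_sub hφ a ha ‖a‖ le_rfl)).2
  have h2 := (Complex.le_def.1 (aux_one hφ)).2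
  simp at h1 h2
  rw [← h2] at h1
  simpa using h1

theorem aux_re {A : Type*} [CStarAlgebra A] {φ : A →L[ℂ] ℂ} (hφ : IsPositiveFunctional φ)
    (x : A) : (φ x).re = (φ (realPart x : A)).re := by
  have h := aux_im hφ (imaginaryPart x : A) (imaginaryPart x).2
  conv_lhs => rw [← realPart_add_I_smul_imaginaryPart x]
  simp [h]

theorem aux_rot {A : Type*} [CStarAlgebra A] {φ ψ : A →L[ℂ] ℂ} (hφ : IsPositiveFunctional φ)
    (hψ : IsPositiveFunctional ψ) (x : A) :
    ∃ a : A, IsSelfAdjoint a ∧ ‖a‖ ≤ ‖x‖ ∧ ‖(φ - ψ) x‖ = (φ a).re - (ψ a).re := by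
  obtain ⟨u, hu, hux⟩ : ∃ u : ℂ, ‖u‖ = 1 ∧ (‖(φ - ψ) x‖ : ℂ) = u * (φ - ψ) x :=
    RCLike.exists_norm_eq_mul_self ((φ - ψ) x)
  refine ⟨(realPart (u • x) : A), (realPart (u • x)).2, ?_, ?_⟩
  · calc _ ≤ ‖u • x‖ := realPart.norm_le (u • x)
      _ = ‖x‖ := by rw [norm_smul, hu, one_mul]
  · rw [← aux_re hφ, ← aux_re hψ, ← Complex.sub_re]
    have := congrArg Complex.re hux
    rw [Complex.ofReal_re] at this
    rw [this]
    simp [mul_sub]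

theorem aux_zero {A : Type*} [CStarAlgebra A] : IsPositiveFunctional (0 : A →L[ℂ] ℂ) := by
  intro a
  simp

theorem aux_norm {A : Type*} [CStarAlgebra A] {φ : A →L[ℂ] ℂ} (hφ : IsPositiveFunctional φ) :
    ‖φ‖ = (φ 1).re := by
  have h0 := (Complex.le_def.1 (aux_one hφ)).1
  have h0i := (Complex.le_def.1 (aux_one hφ)).2
  simp at h0 h0i
  apply le_antisymm
  · refine φ.opNorm_le_bound h0 fun x => ?_
    obtain ⟨a, ha, han, h⟩ := aux_rot hφ aux_zero x
    have := (Complex.le_def.1 (aux_sub hφ a ha ‖x‖ han)).1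
    simp at this h
    rw [h]
    linarith
  · rcases subsingleton_or_nontrivial A with hA | hA
    · rw [Subsingleton.elim (1 : A) 0]
      simp
    · calc (φ 1).re ≤ ‖φ 1‖ := Complex.re_le_norm _
        _ ≤ ‖φ‖ * ‖(1 : A)‖ := φ.le_opNorm 1
        _ = ‖φ‖ := by rw [CStarRing.norm_one, mul_one]

theorem aux_dom {A : Type*} [CStarAlgebra A] {φ φ' : A →L[ℂ] ℂ} {γ : ℝ}
    (h : IsPositiveFunctional ((γ : ℂ) • φ' - φ)) (a : A) (ha : IsSelfAdjoint a)
    (hn : ‖a‖ ≤ 1) : (φ 1).re - (φ a).re ≤ γ * ((φ' 1).re - (φ' a).re) := by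
  have := (Complex.le_def.1 (aux_sub h a ha 1 hn)).1
  simp at this
  linarith

/-- If `φ₁ ≤ φ₂` and `ψ₁ ≤ ψ₂` (domination of positive functionals) and `φ₂ ⊥ ψ₂`
(orthogonality: `‖φ₂ − ψ₂‖ = ‖φ₂‖ + ‖ψ₂‖`), then `φ₁ ⊥ ψ₁`. -/
theorem statement10 {A : Type*} [CStarAlgebra A]
    (φ₁ φ₂ ψ₁ ψ₂ : A →L[ℂ] ℂ)
    (hφ₁ : IsPositiveFunctional φ₁) (hφ₂ : IsPositiveFunctional φ₂)
    (hψ₁ : IsPositiveFunctional ψ₁) (hψ₂ : IsPositiveFunctional ψ₂)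
    (hdomφ : ∃ γ₁ : ℝ, 0 < γ₁ ∧ IsPositiveFunctional ((γ₁ : ℂ) • φ₂ - φ₁))
    (hdomψ : ∃ γ₂ : ℝ, 0 < γ₂ ∧ IsPositiveFunctional ((γ₂ : ℂ) • ψ₂ - ψ₁))
    (horth : ‖φ₂ - ψ₂‖ = ‖φ₂‖ + ‖ψ₂‖) :
    ‖φ₁ - ψ₁‖ = ‖φ₁‖ + ‖ψ₁‖ := by
  obtain ⟨γ₁, hγ₁, hd₁⟩ := hdomφ
  obtain ⟨γ₂, hγ₂, hd₂⟩ := hdomψ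
  refine le_antisymm (norm_sub_le _ _) (le_of_forall_pos_le_add fun ε hε => ?_)
  rw [aux_norm hφ₂, aux_norm hψ₂] at horth
  rw [aux_norm hφ₁, aux_norm hψ₁]
  have hδ : 0 < ε / (γ₁ + γ₂) := by positivity
  obtain ⟨x, hx, hxn⟩ : ∃ x : A, ‖x‖ ≤ 1 ∧
      ‖φ₂ - ψ₂‖ - ε / (γ₁ + γ₂) < ‖(φ₂ - ψ₂) x‖ := by
    obtain ⟨x, hx, h⟩ := (φ₂ - ψ₂).exists_lt_apply_of_lt_opNorm (sub_lt_self _ hδ)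
    exact ⟨x, hx.le, h⟩
  obtain ⟨a, ha, han, h⟩ := aux_rot hφ₂ hψ₂ x
  have ha1 := han.trans hx
  have hna1 : ‖-a‖ ≤ 1 := by rwa [norm_neg]
  have e1 := aux_dom hd₁ a ha ha1
  have e2 := aux_dom hd₂ (-a) ha.neg hna1
  have p1 := (Complex.le_def.1 (aux_sub hφ₂ a ha 1 ha1)).1
  have p2 := (Complex.le_def.1 (aux_sub hψ₂ (-a) ha.neg 1 hna1)).1
  have e3 : (φ₁ a).re - (ψ₁ a).re ≤ ‖φ₁ - ψ₁‖ := by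
    calc _ = ((φ₁ - ψ₁) a).re := by simp
      _ ≤ ‖(φ₁ - ψ₁) a‖ := Complex.re_le_norm _
      _ ≤ ‖φ₁ - ψ₁‖ := (φ₁ - ψ₁).unit_le_opNorm a ha1
  simp at e2 p1 p2
  have q1 : γ₁ * ((φ₂ 1).re - (φ₂ a).re) ≤ γ₁ * (ε / (γ₁ + γ₂)) := by
    gcongr
    linarith
  have q2 : γ₂ * ((ψ₂ 1).re + (ψ₂ a).re) ≤ γ₂ * (ε / (γ₁ + γ₂)) := by
    gcongr
    linarith
  have q3 : γ₁ * (ε / (γ₁ + γ₂)) + γ₂ * (ε / (γ₁ + γ₂)) = ε := by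
    field_simp
  linarith
end

section
/- Let φ and ψ be positive continuous linear functionals on A such that φ and ψ are orthogonal, i.e. ‖φ − ψ‖ = ‖φ‖ + ‖ψ‖, and such that φ is dominated by ψ, i.e. there exists γ > 0 with γψ − φ positive. Then φ = 0. (The content underlying the lemma that if φ_v ⊥ φ_w then (H_v, π, v) is not isomorphic to a subrepresentation of (H_w, π, w).) -/
open scoped ComplexOrder

/-- Upper bound for the norm of a positive functional by its value at the unit. -/
theorem positive_norm_le {A : Type*} [CStarAlgebra A] (θ : A →L[ℂ] ℂ)
    (h : IsPositiveFunctional θ) : ‖θ‖ ≤ (θ 1).re := by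
  letI : PartialOrder A := CStarAlgebra.spectralOrder A
  haveI : StarOrderedRing A := CStarAlgebra.spectralOrderedRing A
  let f : A →ₚ[ℂ] ℂ := PositiveLinearMap.mk₀ θ.toLinearMap (by
    intro x hx
    obtain ⟨y, rfl⟩ := CStarAlgebra.nonneg_iff_eq_star_mul_self.mp hx
    exact h y)
  have hf : ∀ x, f x = θ x := fun x => rfl
  have h1 : 0 ≤ (θ 1).re := by
    have := (Complex.le_def.mp (h 1)).1
    simpa using this
  refine ContinuousLinearMap.opNorm_le_bound _ h1 fun a => ?_
  have hcs := norm_inner_le_norm (𝕜 := ℂ) (f.toPreGNS 1) (f.toPreGNS a)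
  rw [PositiveLinearMap.preGNS_inner_def, PositiveLinearMap.preGNS_norm_def,
    PositiveLinearMap.preGNS_norm_def] at hcs
  simp only [PositiveLinearMap.ofPreGNS_toPreGNS, star_one, one_mul, hf] at hcs
  have hle : (θ (star a * a)).re ≤ (θ 1).re * ‖a‖ ^ 2 := by
    have h2 : f (star a * a) ≤ f (algebraMap ℝ A (‖a‖ ^ 2)) :=
      f.monotone' CStarAlgebra.star_mul_le_algebraMap_norm_sq
    have h3 : algebraMap ℝ A (‖a‖ ^ 2) = ((‖a‖ ^ 2 : ℝ) : ℂ) • (1 : A) := by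
      rw [Algebra.algebraMap_eq_smul_one, Complex.coe_smul]
    rw [h3, hf, hf, map_smul] at h2
    have h4 := (Complex.le_def.mp h2).1
    rw [smul_eq_mul, Complex.re_ofReal_mul] at h4
    linarith
  calc ‖θ a‖ ≤ √(θ 1).re * √(θ (star a * a)).re := hcs
    _ ≤ √(θ 1).re * √((θ 1).re * ‖a‖ ^ 2) := by gcongr
    _ = (θ 1).re * ‖a‖ := by
      rw [Real.sqrt_mul h1, Real.sqrt_sq (norm_nonneg a), ← mul_assoc, Real.mul_self_sqrt h1]

/-- The value at the unit is bounded by the norm. -/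
theorem re_one_le_norm {A : Type*} [CStarAlgebra A] (θ : A →L[ℂ] ℂ) : (θ 1).re ≤ ‖θ‖ := by
  rcases subsingleton_or_nontrivial A with hA | hA
  · have : (1 : A) = 0 := Subsingleton.elim _ _
    rw [this]; simp
  · calc (θ 1).re ≤ ‖θ 1‖ := Complex.re_le_norm _
      _ ≤ ‖θ‖ * ‖(1 : A)‖ := θ.le_opNorm 1
      _ = ‖θ‖ := by rw [CStarRing.norm_one, mul_one]

/-- If `φ` and `ψ` are positive functionals with `φ ⊥ ψ` (`‖φ − ψ‖ = ‖φ‖ + ‖ψ‖`) and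
`φ ≤ ψ` (there is `γ > 0` with `γψ − φ` positive), then `φ = 0`. -/
theorem statement11 {A : Type*} [CStarAlgebra A]
    (φ ψ : A →L[ℂ] ℂ)
    (hφ : IsPositiveFunctional φ) (hψ : IsPositiveFunctional ψ)
    (horth : ‖φ - ψ‖ = ‖φ‖ + ‖ψ‖)
    (hdom : ∃ γ : ℝ, 0 < γ ∧ IsPositiveFunctional ((γ : ℂ) • ψ - φ)) :
    φ = 0 := by
  obtain ⟨γ, hγ, hd⟩ := hdom
  obtain ⟨t, ht0, ht1, htγ⟩ : ∃ t : ℝ, 0 < t ∧ t ≤ 1 ∧ t * γ ≤ 1 := by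
    refine ⟨min 1 γ⁻¹, by positivity, min_le_left _ _, ?_⟩
    calc min 1 γ⁻¹ * γ ≤ γ⁻¹ * γ := by gcongr; exact min_le_right _ _
      _ = 1 := inv_mul_cancel₀ hγ.ne'
  have hpos : IsPositiveFunctional (ψ - (t : ℂ) • φ) := by
    intro a
    have e : (ψ - (t : ℂ) • φ) (star a * a)
        = ((1 - t * γ : ℝ) : ℂ) * ψ (star a * a)
          + (t : ℂ) * (((γ : ℂ) • ψ - φ) (star a * a)) := by
      simp
      ring
    rw [e]
    have i1 : (0 : ℂ) ≤ ((1 - t * γ : ℝ) : ℂ) := by exact_mod_cast sub_nonneg.mpr htγ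
    have i2 : (0 : ℂ) ≤ (t : ℂ) := by exact_mod_cast ht0.le
    exact add_nonneg (mul_nonneg i1 (hψ a)) (mul_nonneg i2 (hd a))
  have e : φ - ψ = ((1 - t : ℝ) : ℂ) • φ - (ψ - (t : ℂ) • φ) := by
    ext a
    simp
    ring
  have n1 : ‖φ - ψ‖ ≤ (1 - t) * ‖φ‖ + ‖ψ - (t : ℂ) • φ‖ := by
    rw [e]
    refine (norm_sub_le _ _).trans ?_
    rw [norm_smul, Complex.norm_real, Real.norm_of_nonneg (by linarith)]
  have n2 := positive_norm_le _ hpos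
  have n3 : ((ψ - (t : ℂ) • φ) 1).re = (ψ 1).re - t * (φ 1).re := by
    simp
  have n4 := positive_norm_le _ hφ
  have n5 := re_one_le_norm ψ
  have n6 : t * ‖φ‖ ≤ t * (φ 1).re := by gcongr
  have n7 : t * ‖φ‖ ≤ 0 := by nlinarith
  have n8 : ‖φ‖ ≤ 0 := by
    by_contra hc
    have := mul_pos ht0 (not_le.mp hc)
    linarith
  exact norm_le_zero_iff.mp n8
end

section
/- Let v, w ∈ H and let H_v and H_w be the smallest closed subspaces of H containing π(a)v, respectively π(a)w, for all a ∈ A. Suppose the representations generated by v and w are disjoint, i.e.: whenever K₁ ⊆ H_v and K₂ ⊆ H_w are closed subspaces with π(a)K₁ ⊆ K₁ and π(a)K₂ ⊆ K₂ for all a ∈ A, and U : K₁ → K₂ is a surjective linear isometry satisfying U(π(a)x) = π(a)(Ux) for all a ∈ A and x ∈ K₁, then K₁ = {0}. Then φ_v and φ_w are orthogonal, i.e. ‖φ_v − φ_w‖ = ‖φ_v‖ + ‖φ_w‖. (One direction of the theorem characterizing orthogonality of the functionals φ_v and φ_w via common subrepresentations.) -/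
open scoped ComplexInnerProductSpace CStarAlgebra

/-- The positive linear functional `φ_v : a ↦ ⟪π a v, v⟫` (written in the mathematicians'
convention, linear in `a`) as a continuous linear functional on `A`. -/
noncomputable def phiCLM {A H : Type*} [CStarAlgebra A]
    [NormedAddCommGroup H] [InnerProductSpace ℂ H] [CompleteSpace H]
    (π : A →⋆ₐ[ℂ] (H →L[ℂ] H)) (v : H) : A →L[ℂ] ℂ :=
  (innerSL ℂ v).comp ((ContinuousLinearMap.apply ℂ H v).comp
    (⟨π.toLinearMap, map_continuous π⟩ : A →L[ℂ] (H →L[ℂ] H)))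

/-- For `v ∈ H`, the smallest closed subspace of `H` containing `π a v` for all `a ∈ A`. -/
abbrev cyclicSubspace {A H : Type*} [CStarAlgebra A]
    [NormedAddCommGroup H] [InnerProductSpace ℂ H] [CompleteSpace H]
    (π : A →⋆ₐ[ℂ] (H →L[ℂ] H)) (v : H) : Submodule ℂ H :=
  (Submodule.span ℂ (Set.range fun a : A => π a v)).topologicalClosure

set_option linter.unusedSectionVars false

section helpers

variable {A H : Type*} [CStarAlgebra A]
    [NormedAddCommGroup H] [InnerProductSpace ℂ H] [CompleteSpace H]

lemma starProj_comm_aux {V : Type*} [NormedAddCommGroup V] [InnerProductSpace ℂ V]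
    (K : Submodule ℂ V) [K.HasOrthogonalProjection] (T T' : V →ₗ[ℂ] V)
    (hadj : ∀ x y, ⟪T x, y⟫ = ⟪x, T' y⟫) (h1 : ∀ x ∈ K, T x ∈ K) (h2 : ∀ x ∈ K, T' x ∈ K) (x : V) :
    K.starProjection (T x) = T (K.starProjection x) := by
  apply Submodule.eq_starProjection_of_mem_of_inner_eq_zero
  · exact h1 _ (Submodule.starProjection_apply_mem _ _)
  · intro k hk
    rw [← map_sub, hadj]
    exact Submodule.inner_left_of_mem_orthogonal (h2 k hk)
      (Submodule.sub_starProjection_mem_orthogonal x)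

lemma pi_adj (π : A →⋆ₐ[ℂ] (H →L[ℂ] H)) (a : A) (x y : H) :
    ⟪π a x, y⟫ = ⟪x, π (star a) y⟫ := by
  rw [map_star, ContinuousLinearMap.star_eq_adjoint, ContinuousLinearMap.adjoint_inner_right]

lemma closure_inv_aux {V : Type*} [NormedAddCommGroup V] [InnerProductSpace ℂ V]
    (K : Submodule ℂ V) (T : V → V) (hT : Continuous T) (h : ∀ x ∈ K, T x ∈ K)
    (x : V) (hx : x ∈ K.topologicalClosure) : T x ∈ K.topologicalClosure := by
  rw [← SetLike.mem_coe, Submodule.topologicalClosure_coe] at *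
  exact map_mem_closure hT hx h

lemma cyclic_inv (π : A →⋆ₐ[ℂ] (H →L[ℂ] H)) (v : H) (a : A) (x : H)
    (hx : x ∈ cyclicSubspace π v) : π a x ∈ cyclicSubspace π v := by
  refine closure_inv_aux _ (π a) (π a).continuous ?_ x hx
  intro x hx
  induction hx using Submodule.span_induction with
  | mem x h =>
    obtain ⟨b, rfl⟩ := h
    exact Submodule.subset_span ⟨a * b, by simp⟩
  | zero => simp
  | add x y _ _ hx hy => rw [map_add]; exact add_mem hx hy
  | smul c x _ hx => rw [map_smul]; exact Submodule.smul_mem _ _ hx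

lemma mem_cyclic (π : A →⋆ₐ[ℂ] (H →L[ℂ] H)) (v : H) (a : A) : π a v ∈ cyclicSubspace π v :=
  Submodule.le_topologicalClosure _ (Submodule.subset_span ⟨a, rfl⟩)

lemma self_mem_cyclic (π : A →⋆ₐ[ℂ] (H →L[ℂ] H)) (v : H) : v ∈ cyclicSubspace π v := by
  simpa using mem_cyclic π v 1

instance (π : A →⋆ₐ[ℂ] (H →L[ℂ] H)) (v : H) : (cyclicSubspace π v).HasOrthogonalProjection := by
  have : CompleteSpace (cyclicSubspace π v) :=
    (Submodule.isClosed_topologicalClosure _).completeSpace_coe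
  infer_instance

/-- Disjointness of the representations generated by `v` and `w`. -/
def DisjRep (π : A →⋆ₐ[ℂ] (H →L[ℂ] H)) (v w : H) : Prop :=
  ∀ K₁ K₂ : Submodule ℂ H,
      K₁ ≤ cyclicSubspace π v → K₂ ≤ cyclicSubspace π w →
      IsClosed (K₁ : Set H) → IsClosed (K₂ : Set H) →
      (∀ (a : A), ∀ x ∈ K₁, π a x ∈ K₁) → (∀ (a : A), ∀ x ∈ K₂, π a x ∈ K₂) →
      ∀ U : K₁ ≃ₗᵢ[ℂ] K₂,
        (∀ (a : A) (x y : K₁), (y : H) = π a (x : H) → ((U y : H) = π a ((U x) : H))) →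
        K₁ = ⊥

/-- An operator corestricted to the closure of its range. -/
noncomputable def corestr (S : H →L[ℂ] H) : H →ₗ[ℂ] (LinearMap.range S.toLinearMap).topologicalClosure :=
  S.toLinearMap.codRestrict _ (fun x => Submodule.le_topologicalClosure _ ⟨x, rfl⟩)

lemma corestr_dense (S : H →L[ℂ] H) : DenseRange (corestr S) := by
  intro ⟨y, hy⟩
  rw [closure_subtype]
  rw [← SetLike.mem_coe, Submodule.topologicalClosure_coe] at hy
  convert hy using 2
  ext z
  simp only [Set.mem_image, Set.mem_range]
  constructor
  · rintro ⟨_, ⟨x, rfl⟩, rfl⟩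
    exact ⟨x, rfl⟩
  · rintro ⟨x, rfl⟩
    exact ⟨_, ⟨x, rfl⟩, rfl⟩

lemma range_closure_le (S : H →L[ℂ] H) (K : Submodule ℂ H) (hK : IsClosed (K : Set H))
    (h : ∀ x, S x ∈ K) : (LinearMap.range S.toLinearMap).topologicalClosure ≤ K := by
  apply Submodule.topologicalClosure_minimal _ _ hK
  rintro _ ⟨x, rfl⟩
  exact h x

lemma range_inv (π : A →⋆ₐ[ℂ] (H →L[ℂ] H)) (S : H →L[ℂ] H)
    (hc : ∀ a x, S (π a x) = π a (S x)) (a : A) (x : H)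
    (hx : x ∈ (LinearMap.range S.toLinearMap).topologicalClosure) :
    π a x ∈ (LinearMap.range S.toLinearMap).topologicalClosure := by
  refine closure_inv_aux _ (π a) (π a).continuous ?_ x hx
  rintro _ ⟨y, rfl⟩
  exact ⟨π a y, hc a y⟩

lemma intertwiner_zero (π : A →⋆ₐ[ℂ] (H →L[ℂ] H)) (v w : H) (hd : DisjRep π v w)
    (S : H →L[ℂ] H) (hc : ∀ a x, S (π a x) = π a (S x))
    (hr : ∀ x, S x ∈ cyclicSubspace π w)
    (hk : ∀ x ∈ (cyclicSubspace π v)ᗮ, S x = 0) : S = 0 := by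
  set R : H →L[ℂ] H := CFC.abs S with hR
  have hRR : R * R = star S * S := CFC.abs_mul_abs S
  have hRsa : star R = R := (IsSelfAdjoint.of_nonneg (CFC.abs_nonneg S))
  have hRin : ∀ x y, ⟪R x, y⟫ = ⟪x, R y⟫ := by
    intro x y
    conv_rhs => rw [← hRsa, ContinuousLinearMap.star_eq_adjoint]
    rw [ContinuousLinearMap.adjoint_inner_right]
  have hnorm : ∀ x, ‖S x‖ = ‖R x‖ := by
    intro x
    have h1 : ⟪S x, S x⟫ = ⟪R x, R x⟫ := by
      rw [hRin, ← ContinuousLinearMap.adjoint_inner_right]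
      have := congrArg (fun T : H →L[ℂ] H => T x) hRR
      simp only [mul_apply_eq_comp, ContinuousLinearMap.star_eq_adjoint] at this
      rw [this]
    rw [inner_self_eq_norm_sq_to_K, inner_self_eq_norm_sq_to_K] at h1
    have h2 : ‖S x‖ ^ 2 = ‖R x‖ ^ 2 := by exact_mod_cast h1
    exact (sq_eq_sq₀ (norm_nonneg _) (norm_nonneg _)).1 h2
  have hcomm : ∀ a, Commute S (π a) := by
    intro a
    ext x
    exact hc a x
  have hRc : ∀ a x, R (π a x) = π a (R x) := by
    intro a x
    have h : Commute R (π a) := Commute.cfcAbs_left (hcomm a) (by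
      rw [← map_star]; exact hcomm _)
    exact congrArg (fun T : H →L[ℂ] H => T x) h.eq
  have hRv : ∀ x, R x ∈ cyclicSubspace π v := by
    intro x
    rw [← Submodule.orthogonal_orthogonal (cyclicSubspace π v), Submodule.mem_orthogonal']
    intro y hy
    rw [hRin]
    have : R y = 0 := by rw [← norm_eq_zero, ← hnorm, hk y hy, norm_zero]
    rw [this, inner_zero_right]
  have hnorm' : ∀ x, ‖corestr S ((LinearEquiv.refl ℂ H) x)‖ = ‖corestr R x‖ := hnorm
  have hb := hd _ _ (range_closure_le R _ (Submodule.isClosed_topologicalClosure _) hRv)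
    (range_closure_le S _ (Submodule.isClosed_topologicalClosure _) hr)
    (Submodule.isClosed_topologicalClosure _) (Submodule.isClosed_topologicalClosure _)
    (range_inv π R hRc) (range_inv π S hc)
    ((LinearEquiv.refl ℂ H).extendOfIsometry (corestr R) (corestr S)
      (corestr_dense R) (corestr_dense S) hnorm') (by
      set U := ((LinearEquiv.refl ℂ H).extendOfIsometry (corestr R) (corestr S)
        (corestr_dense R) (corestr_dense S) hnorm') with hU
      have hUa : ∀ x, U (corestr R x) = corestr S x := fun x =>
        LinearEquiv.extendOfIsometry_eq _ _ _ (corestr_dense R) (corestr_dense S) hnorm' x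
      intro a x y hxy
      let P : (LinearMap.range R.toLinearMap).topologicalClosure →
          (LinearMap.range R.toLinearMap).topologicalClosure :=
        fun x => ⟨π a x, range_inv π R hRc a x x.2⟩
      have hP : Continuous P := by
        apply Continuous.subtype_mk
        fun_prop
      have hy : y = P x := Subtype.ext hxy
      rw [hy]
      refine DenseRange.induction_on (corestr_dense R)
        (p := fun x => ((U (P x) : H) = π a ((U x) : H))) x ?_ ?_
      · apply isClosed_eq
        · exact continuous_subtype_val.comp (U.continuous.comp hP)
        · exact (π a).continuous.comp (continuous_subtype_val.comp U.continuous)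
      · intro z
        have : P (corestr R z) = corestr R (π a z) := Subtype.ext (hRc a z).symm
        rw [this, hUa, hUa]
        exact hc a z)
  ext x
  have : R x ∈ (LinearMap.range R.toLinearMap).topologicalClosure :=
    Submodule.le_topologicalClosure _ ⟨x, rfl⟩
  rw [hb, Submodule.mem_bot] at this
  rw [zero_apply, ← norm_eq_zero, hnorm, this, norm_zero]

lemma commutant_inner_zero (π : A →⋆ₐ[ℂ] (H →L[ℂ] H)) (v w : H) (hd : DisjRep π v w)
    (T : H →L[ℂ] H) (hc : ∀ a x, T (π a x) = π a (T x)) (x y : H)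
    (hx : x ∈ cyclicSubspace π v) (hy : y ∈ cyclicSubspace π w) : ⟪T x, y⟫ = 0 := by
  have hQ : ∀ (u : H) (a : A) (z : H), (cyclicSubspace π u).starProjection (π a z) =
      π a ((cyclicSubspace π u).starProjection z) := fun u a z =>
    starProj_comm_aux (cyclicSubspace π u) (π a).toLinearMap (π (star a)).toLinearMap
      (pi_adj π a) (cyclic_inv π u a) (cyclic_inv π u (star a)) z
  have h0 := intertwiner_zero π v w hd
    ((cyclicSubspace π w).starProjection ∘L T ∘L (cyclicSubspace π v).starProjection)
    (by intro a x; simp [hQ, hc])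
    (by intro x; exact Submodule.starProjection_apply_mem _ _)
    (by intro x hx; simp [(Submodule.starProjection_apply_eq_zero_iff _).2 hx])
  have h1 := congrArg (fun T : H →L[ℂ] H => T x) h0
  simp only [ContinuousLinearMap.comp_apply, zero_apply,
    Submodule.starProjection_eq_self_iff.2 hx] at h1
  rw [← Submodule.starProjection_eq_self_iff.2 hy, ← Submodule.inner_starProjection_left_eq_right,
    h1, inner_zero_left]

lemma sub_mem_aux {V : Type*} [NormedAddCommGroup V] [InnerProductSpace ℂ V]
    (K : Submodule ℂ V) [K.HasOrthogonalProjection] (p q : V) (h : p + q ∈ K)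
    (h1 : ⟪p, q⟫ = 0) (h2 : ⟪K.starProjection p, q⟫ = 0) : p - q ∈ K := by
  have e := Submodule.starProjection_eq_self_iff.2 h
  rw [map_add] at e
  have e2 : K.starProjection p - p = q - K.starProjection q := by
    rw [sub_eq_sub_iff_add_eq_add, e, add_comm]
  have h3 : ⟪K.starProjection p, K.starProjection q⟫ = 0 := by
    rw [← Submodule.inner_starProjection_left_eq_right,
      Submodule.starProjection_eq_self_iff.2 (Submodule.starProjection_apply_mem _ _), h2]
  have h4 : ⟪p, K.starProjection q⟫ = 0 := by
    rw [← Submodule.inner_starProjection_left_eq_right, h2]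
  have h5 : ⟪K.starProjection p - p, K.starProjection p - p⟫ = 0 := by
    nth_rewrite 2 [e2]
    rw [inner_sub_left, inner_sub_right, inner_sub_right, h1, h2, h3, h4]
    simp
  have h6 := inner_self_eq_zero.1 h5
  have hp : p ∈ K := Submodule.starProjection_eq_self_iff.1 (sub_eq_zero.1 h6)
  have hq : q ∈ K := by simpa using sub_mem h hp
  exact sub_mem hp hq

/-- The diagonal amplification of an operator. -/
noncomputable def dg (T : H →L[ℂ] H) :
    PiLp 2 (fun _ : Fin 4 => H) →ₗ[ℂ] PiLp 2 (fun _ : Fin 4 => H) where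
  toFun x := WithLp.toLp 2 (fun i => T (x i))
  map_add' x y := by ext i; simp
  map_smul' c x := by ext i; simp

/-- The inclusion of a coordinate. -/
noncomputable def sgl (j : Fin 4) : H →L[ℂ] PiLp 2 (fun _ : Fin 4 => H) :=
  (PiLp.continuousLinearEquiv 2 ℂ (fun _ : Fin 4 => H)).symm.toContinuousLinearMap ∘L
    ContinuousLinearMap.single ℂ (fun _ : Fin 4 => H) j

lemma sgl_apply (j i : Fin 4) (h : H) : (sgl j h) i = if i = j then h else 0 := by
  change (Pi.single j h : Fin 4 → H) i = _
  rw [Pi.single_apply]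

lemma inner_sgl (j : Fin 4) (z : PiLp 2 (fun _ : Fin 4 => H)) (h : H) :
    ⟪z, sgl j h⟫ = ⟪z j, h⟫ := by
  rw [PiLp.inner_apply, Finset.sum_eq_single j]
  · simp [sgl_apply]
  · intro i _ hi; simp [sgl_apply, hi]
  · simp

lemma dens4 (π : A →⋆ₐ[ℂ] (H →L[ℂ] H)) (v w : H) (hd : DisjRep π v w) (x x' y y' : H)
    (hx : x ∈ cyclicSubspace π v) (hx' : x' ∈ cyclicSubspace π v)
    (hy : y ∈ cyclicSubspace π w) (hy' : y' ∈ cyclicSubspace π w) :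
    (sgl 0 x + sgl 1 x') - (sgl 2 y + sgl 3 y') ∈
      closure (Set.range fun c : A => dg (π c) ((sgl 0 x + sgl 1 x') + (sgl 2 y + sgl 3 y'))) := by
  set X := (sgl 0 x + sgl 1 x') + (sgl 2 y + sgl 3 y') with hX
  let m : A →ₗ[ℂ] PiLp 2 (fun _ : Fin 4 => H) :=
    { toFun := fun c => dg (π c) X
      map_add' := by intro a b; ext i; simp [dg]
      map_smul' := by intro a b; ext i; simp [dg] }
  set M := (LinearMap.range m).topologicalClosure with hM
  have : CompleteSpace M := (Submodule.isClosed_topologicalClosure _).completeSpace_coe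
  have hdc : ∀ T : H →L[ℂ] H, Continuous (dg T) := by
    intro T
    refine (PiLp.continuous_toLp 2 (fun _ : Fin 4 => H)).comp ?_
    exact continuous_pi fun i => T.continuous.comp (PiLp.continuous_apply 2 (fun _ : Fin 4 => H) i)
  suffices h : (sgl 0 x + sgl 1 x') - (sgl 2 y + sgl 3 y') ∈ M by
    rw [← SetLike.mem_coe, Submodule.topologicalClosure_coe] at h
    exact h
  have hinv : ∀ a, ∀ z ∈ M, dg (π a) z ∈ M := by
    intro a z hz
    refine closure_inv_aux _ (dg (π a)) (hdc _) ?_ z hz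
    rintro _ ⟨c, rfl⟩
    refine ⟨a * c, ?_⟩
    ext i
    simp [m, dg]
  have hcomm : ∀ a z, M.starProjection (dg (π a) z) = dg (π a) (M.starProjection z) := by
    intro a z
    refine starProj_comm_aux M (dg (π a)) (dg (π (star a))) ?_ (hinv a) (hinv _) z
    intro z z'
    simp only [PiLp.inner_apply, dg]
    exact Finset.sum_congr rfl fun i _ => pi_adj π a _ _
  have key : ∀ (i j : Fin 4) (h k : H), h ∈ cyclicSubspace π v → k ∈ cyclicSubspace π w →
      ⟪M.starProjection (sgl j h), sgl i k⟫ = 0 := by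
    intro i j h k hh hk
    rw [inner_sgl]
    refine commutant_inner_zero π v w hd
      (PiLp.proj 2 (fun _ : Fin 4 => H) i ∘L M.starProjection ∘L sgl j) ?_ h k hh hk
    intro a z
    have e : sgl j (π a z) = dg (π a) (sgl j z) := by
      ext i
      by_cases hi : i = j <;> simp [sgl_apply, dg, hi]
    simp only [ContinuousLinearMap.comp_apply, e, hcomm]
    rfl
  apply sub_mem_aux
  · apply Submodule.le_topologicalClosure
    exact ⟨1, by ext i; simp [m, dg, hX]⟩
  · simp only [inner_add_right, inner_sgl]
    simp [sgl_apply]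
  · simp only [map_add, inner_add_left, inner_add_right, key _ _ _ _ hx hy, key _ _ _ _ hx' hy,
      key _ _ _ _ hx hy', key _ _ _ _ hx' hy', add_zero]

lemma sa_dense (π : A →⋆ₐ[ℂ] (H →L[ℂ] H)) (v w : H) (hd : DisjRep π v w) :
    (v, -w) ∈ closure ((fun a : A => (π a v, π a w)) '' {a | IsSelfAdjoint a}) := by
  by_contra hcon
  have hconv : Convex ℝ ((fun a : A => (π a v, π a w)) '' {a | IsSelfAdjoint a}) := by
    rintro _ ⟨a, ha, rfl⟩ _ ⟨b, hb, rfl⟩ s t _ _ _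
    refine ⟨(s : ℂ) • a + (t : ℂ) • b, ?_, ?_⟩
    · have ha' : star a = a := ha
      have hb' : star b = b := hb
      simp [isSelfAdjoint_iff, ha', hb']
    · simp only [map_add, map_smul]
      rfl
  obtain ⟨f, u, hu1, hu2⟩ := RCLike.geometric_hahn_banach_point_closed (𝕜 := ℂ)
    hconv.closure isClosed_closure hcon
  have hf0 : f (0, 0) = 0 := map_zero f
  have hu0 : u < 0 := by
    have := hu2 _ (subset_closure ⟨0, IsSelfAdjoint.zero A, rfl⟩)
    simpa [hf0] using this
  have hz : ∀ a : A, IsSelfAdjoint a → (f (π a v, π a w)).re = 0 := by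
    intro a ha
    by_contra hne
    have h1 : ∀ t : ℝ, u < t * (f (π a v, π a w)).re := by
      intro t
      have := hu2 _ (subset_closure ⟨(t : ℂ) • a, by
        have ha' : star a = a := ha
        simp [isSelfAdjoint_iff, ha'], rfl⟩)
      have e : (π ((t : ℂ) • a) v, π ((t : ℂ) • a) w) = (t : ℂ) • (π a v, π a w) := by
        simp only [map_smul]
        rfl
      change u < RCLike.re (f (π ((t : ℂ) • a) v, π ((t : ℂ) • a) w)) at this
      rw [e, map_smul] at this
      simpa using this
    have := h1 (u / (f (π a v, π a w)).re)
    rw [div_mul_cancel₀ _ hne] at this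
    exact lt_irrefl _ this
  -- Riesz representation
  set f1 : StrongDual ℂ H := f ∘L ContinuousLinearMap.inl ℂ H H with hf1
  set f2 : StrongDual ℂ H := f ∘L ContinuousLinearMap.inr ℂ H H with hf2
  set ξ := (cyclicSubspace π v).starProjection ((InnerProductSpace.toDual ℂ H).symm f1) with hξ
  set η := (cyclicSubspace π w).starProjection ((InnerProductSpace.toDual ℂ H).symm f2) with hη
  have hξm : ξ ∈ cyclicSubspace π v := Submodule.starProjection_apply_mem _ _
  have hηm : η ∈ cyclicSubspace π w := Submodule.starProjection_apply_mem _ _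
  have hf : ∀ p q, p ∈ cyclicSubspace π v → q ∈ cyclicSubspace π w →
      f (p, q) = ⟪ξ, p⟫ + ⟪η, q⟫ := by
    intro p q hp hq
    rw [hξ, hη, Submodule.inner_starProjection_left_eq_right,
      Submodule.inner_starProjection_left_eq_right,
      Submodule.starProjection_eq_self_iff.2 hp, Submodule.starProjection_eq_self_iff.2 hq,
      InnerProductSpace.toDual_symm_apply, InnerProductSpace.toDual_symm_apply, hf1, hf2]
    simp [← map_add]
  have hv := self_mem_cyclic π v
  have hw := self_mem_cyclic π w
  have hcl := dens4 π v w hd v ξ w η hv hξm hw hηm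
  have hclosed : IsClosed {m : PiLp 2 (fun _ : Fin 4 => H) |
      (⟪ξ, m 0⟫ + ⟪m 1, v⟫ + (⟪η, m 2⟫ + ⟪m 3, w⟫)).re = 0} := by
    apply isClosed_eq _ continuous_const
    fun_prop
  have hmem := closure_minimal (t := {m : PiLp 2 (fun _ : Fin 4 => H) |
      (⟪ξ, m 0⟫ + ⟪m 1, v⟫ + (⟪η, m 2⟫ + ⟪m 3, w⟫)).re = 0}) (by
    rintro _ ⟨c, rfl⟩
    have h1 := hz (c + star c) (IsSelfAdjoint.add_star_self c)
    rw [hf _ _ (mem_cyclic π v _) (mem_cyclic π w _), map_add] at h1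
    simp only [add_apply, inner_add_right, ← pi_adj] at h1
    simp [dg, sgl_apply]
    simp at h1
    linarith) hclosed hcl
  rw [hf _ _ hv (neg_mem hw)] at hu1
  simp [sgl_apply] at hmem hu1
  have e1 := inner_re_symm (𝕜 := ℂ) v ξ
  have e2 := inner_re_symm (𝕜 := ℂ) w η
  simp only [RCLike.re_to_complex] at e1 e2
  linarith

lemma bdd_aux (π : A →⋆ₐ[ℂ] (H →L[ℂ] H)) (a : A) (x : H) : ‖π a x‖ ≤ ‖a‖ * ‖x‖ :=
  ((π a).le_opNorm x).trans
    (mul_le_mul_of_nonneg_right (NonUnitalStarAlgHom.norm_apply_le π a) (norm_nonneg _))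

lemma cfc_trick (a : A) (ha : IsSelfAdjoint a) : ∃ b g₁ g₂ : A, ‖b‖ ≤ 1 ∧ ‖g₁‖ ≤ 2 ∧ ‖g₂‖ ≤ 2 ∧
    1 - b = g₁ * (1 - a) ∧ 1 + b = g₂ * (1 + a) := by
  have hpos : ∀ t : ℝ, 0 < 1 + t ^ 2 := fun t => by positivity
  have hne : ∀ t : ℝ, 1 + t ^ 2 ≠ 0 := fun t => (hpos t).ne'
  have c0 : Continuous (fun t : ℝ => 2 * t / (1 + t ^ 2)) := by fun_prop (disch := exact hne _)
  have c1 : Continuous (fun t : ℝ => (1 - t) / (1 + t ^ 2)) := by fun_prop (disch := exact hne _)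
  have c2 : Continuous (fun t : ℝ => (1 + t) / (1 + t ^ 2)) := by fun_prop (disch := exact hne _)
  refine ⟨cfc (fun t : ℝ => 2 * t / (1 + t ^ 2)) a, cfc (fun t : ℝ => (1 - t) / (1 + t ^ 2)) a,
    cfc (fun t : ℝ => (1 + t) / (1 + t ^ 2)) a, ?_, ?_, ?_, ?_, ?_⟩
  · refine norm_cfc_le zero_le_one fun t _ => ?_
    rw [Real.norm_eq_abs, abs_div, abs_of_pos (hpos t), div_le_one (hpos t), abs_le]
    constructor <;> nlinarith [sq_nonneg (t - 1), sq_nonneg (t + 1)]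
  · refine norm_cfc_le zero_le_two fun t _ => ?_
    rw [Real.norm_eq_abs, abs_div, abs_of_pos (hpos t), div_le_iff₀ (hpos t), abs_le]
    constructor <;> nlinarith [sq_nonneg (t - 1), sq_nonneg (t + 1)]
  · refine norm_cfc_le zero_le_two fun t _ => ?_
    rw [Real.norm_eq_abs, abs_div, abs_of_pos (hpos t), div_le_iff₀ (hpos t), abs_le]
    constructor <;> nlinarith [sq_nonneg (t - 1), sq_nonneg (t + 1)]
  · have e1 : cfc (fun t : ℝ => 1 - t) a = 1 - a := by
      rw [cfc_sub (fun _ : ℝ => (1 : ℝ)) (fun t => t) a, cfc_const_one ℝ a, cfc_id' ℝ a]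
    rw [← e1, ← cfc_mul _ _ a c1.continuousOn (by fun_prop)]
    nth_rewrite 1 [← cfc_const_one ℝ a]
    rw [← cfc_sub _ _ a (by fun_prop) c0.continuousOn]
    congr 1
    ext t
    have := hne t
    field_simp
    ring
  · have e1 : cfc (fun t : ℝ => 1 + t) a = 1 + a := by
      rw [cfc_add a (fun _ : ℝ => (1 : ℝ)) (fun t => t), cfc_const_one ℝ a, cfc_id' ℝ a]
    rw [← e1, ← cfc_mul _ _ a c2.continuousOn (by fun_prop)]
    nth_rewrite 1 [← cfc_const_one ℝ a]
    rw [← cfc_add a _ _ (by fun_prop) c0.continuousOn]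
    congr 1
    ext t
    have := hne t
    field_simp
    ring

lemma phi_apply (π : A →⋆ₐ[ℂ] (H →L[ℂ] H)) (v : H) (a : A) : phiCLM π v a = ⟪v, π a v⟫ := rfl

lemma phi_norm_le (π : A →⋆ₐ[ℂ] (H →L[ℂ] H)) (v : H) : ‖phiCLM π v‖ ≤ ‖v‖ ^ 2 := by
  refine ContinuousLinearMap.opNorm_le_bound _ (by positivity) fun a => ?_
  rw [phi_apply]
  calc ‖⟪v, π a v⟫‖ ≤ ‖v‖ * ‖π a v‖ := norm_inner_le_norm _ _
    _ ≤ ‖v‖ * (‖a‖ * ‖v‖) := by gcongr; exact bdd_aux π a v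
    _ = _ := by ring

lemma lower_bound (π : A →⋆ₐ[ℂ] (H →L[ℂ] H)) (v w : H) (hd : DisjRep π v w) :
    ‖v‖ ^ 2 + ‖w‖ ^ 2 ≤ ‖phiCLM π v - phiCLM π w‖ := by
  apply le_of_forall_pos_le_add
  intro δ hδ
  set C := 2 * ‖v‖ + 2 * ‖w‖ with hC
  have hC0 : 0 ≤ C := by positivity
  set ε := δ / (C + 1) with hε
  have hε0 : 0 < ε := by positivity
  have hCε : C * ε ≤ δ := by
    have : (C + 1) * ε = δ := by rw [hε]; field_simp
    nlinarith
  obtain ⟨_, ⟨a, ha, rfl⟩, hdist⟩ := Metric.mem_closure_iff.1 (sa_dense π v w hd) ε hε0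
  rw [Prod.dist_eq, max_lt_iff] at hdist
  obtain ⟨h1, h2⟩ := hdist
  rw [dist_eq_norm] at h1
  rw [dist_comm, dist_eq_norm, sub_neg_eq_add] at h2
  obtain ⟨b, g₁, g₂, hb, hg₁, hg₂, e1, e2⟩ := cfc_trick a ha
  have k1 : ‖v - π b v‖ ≤ 2 * ε := by
    have : v - π b v = π g₁ (v - π a v) := by
      have := congrArg (fun c => π c v) e1
      simpa using this
    rw [this]
    refine (bdd_aux π _ _).trans ?_
    gcongr
  have k2 : ‖w + π b w‖ ≤ 2 * ε := by
    have : w + π b w = π g₂ (π a w + w) := by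
      have := congrArg (fun c => π c w) e2
      simpa [add_comm] using this
    rw [this]
    refine (bdd_aux π _ _).trans ?_
    gcongr
  have k3 : ((‖v‖ ^ 2 + ‖w‖ ^ 2 : ℝ) : ℂ) =
      (phiCLM π v - phiCLM π w) b + (⟪v, v - π b v⟫ + ⟪w, w + π b w⟫) := by
    rw [ContinuousLinearMap.sub_apply, phi_apply, phi_apply, inner_sub_right, inner_add_right,
      inner_self_eq_norm_sq_to_K, inner_self_eq_norm_sq_to_K]
    push_cast
    simp only [Complex.coe_algebraMap]
    ring
  have k4 : ‖v‖ ^ 2 + ‖w‖ ^ 2 = ‖((‖v‖ ^ 2 + ‖w‖ ^ 2 : ℝ) : ℂ)‖ := by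
    rw [Complex.norm_real, Real.norm_of_nonneg (by positivity)]
  rw [k4, k3]
  have k5 : ‖(phiCLM π v - phiCLM π w) b‖ ≤ ‖phiCLM π v - phiCLM π w‖ :=
    ((phiCLM π v - phiCLM π w).le_opNorm b).trans
      (mul_le_of_le_one_right (norm_nonneg _) hb)
  have k6 : ‖⟪v, v - π b v⟫‖ ≤ ‖v‖ * (2 * ε) :=
    (norm_inner_le_norm _ _).trans (by gcongr)
  have k7 : ‖⟪w, w + π b w⟫‖ ≤ ‖w‖ * (2 * ε) :=
    (norm_inner_le_norm _ _).trans (by gcongr)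
  have k8 := norm_add_le ((phiCLM π v - phiCLM π w) b) (⟪v, v - π b v⟫ + ⟪w, w + π b w⟫)
  have k9 := norm_add_le ⟪v, v - π b v⟫ ⟪w, w + π b w⟫
  have k10 : C * ε = ‖v‖ * (2 * ε) + ‖w‖ * (2 * ε) := by rw [hC]; ring
  linarith

end helpers

/-- If the representations generated by `v` and `w` are disjoint — any intertwining
surjective linear isometry between closed invariant subspaces `K₁ ⊆ H_v` and `K₂ ⊆ H_w`
forces `K₁ = {0}` — then `φ_v ⊥ φ_w`, i.e. `‖φ_v − φ_w‖ = ‖φ_v‖ + ‖φ_w‖`. -/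
theorem statement13 {A H : Type*} [CStarAlgebra A]
    [NormedAddCommGroup H] [InnerProductSpace ℂ H] [CompleteSpace H]
    (π : A →⋆ₐ[ℂ] (H →L[ℂ] H)) (v w : H)
    (hdisj : ∀ K₁ K₂ : Submodule ℂ H,
      K₁ ≤ cyclicSubspace π v → K₂ ≤ cyclicSubspace π w →
      IsClosed (K₁ : Set H) → IsClosed (K₂ : Set H) →
      (∀ (a : A), ∀ x ∈ K₁, π a x ∈ K₁) → (∀ (a : A), ∀ x ∈ K₂, π a x ∈ K₂) →
      ∀ U : K₁ ≃ₗᵢ[ℂ] K₂,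
        (∀ (a : A) (x y : K₁), (y : H) = π a (x : H) → ((U y : H) = π a ((U x) : H))) →
        K₁ = ⊥) :
    ‖phiCLM π v - phiCLM π w‖ = ‖phiCLM π v‖ + ‖phiCLM π w‖ := by
  apply le_antisymm (norm_sub_le _ _)
  have h1 := phi_norm_le π v
  have h2 := phi_norm_le π w
  have h3 := lower_bound π v w hdisj
  linarith
end
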